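/- Let H : ℝ² → ℝ be real-analytic in a neighborhood of the origin, with H(0,0) = 0 a critical point that is not a local extremum and is isolated among critical points, and let X = (∂H/∂y, −∂H/∂x) be the associated Hamiltonian vector field. Fix a sufficiently small ρ > 0 and a separatrix sector S_ρ ⊂ B_ρ. For small h > 0, let A(h) denote the two-dimensional Lebesgue measure of S_ρ(h) = {p ∈ S_ρ : |H(p)| < h}, and suppose that for each small h > 0 there are τ(h) > 0 and an injective solution γ_h : [0, τ(h)] → ℝ² of γ′ = X(γ) whose image is {p ∈ S_ρ : |H(p)| = h}, with γ_h(0), γ_h(τ(h)) ∈ ∂B_ρ. Then for all sufficiently small h > 0 the function A is differentiable at h and A′(h) = τ(h). -/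

import Mathlib

/-- The closed Euclidean ball of radius `ρ` centered at the origin of `ℝ²`. -/
def euclBall (ρ : ℝ) : Set (ℝ × ℝ) := {p | p.1 ^ 2 + p.2 ^ 2 ≤ ρ ^ 2}

/-- The separatrix sector of `H` in `B_ρ` containing `x₀`: the connected component of
`B_ρ ∩ {H ≠ 0}` containing `x₀`. -/
def sector (H : ℝ × ℝ → ℝ) (ρ : ℝ) (x₀ : ℝ × ℝ) : Set (ℝ × ℝ) :=
  connectedComponentIn {p ∈ euclBall ρ | H p ≠ 0} x₀

/-- The Hamiltonian vector field `X = (∂H/∂y, -∂H/∂x)` of `H`. -/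
noncomputable def hamVF (H : ℝ × ℝ → ℝ) (p : ℝ × ℝ) : ℝ × ℝ :=
  (fderiv ℝ H p (0, 1), -(fderiv ℝ H p (1, 0)))

open Set Filter Topology MeasureTheory

theorem ContinuousLinearMap.det_real_prod (L : ℝ × ℝ →L[ℝ] ℝ × ℝ) :
    L.det = (L (1, 0)).1 * (L (0, 1)).2 - (L (0, 1)).1 * (L (1, 0)).2 := by
  rw [ContinuousLinearMap.det, ← LinearMap.det_toMatrix (Module.Basis.finTwoProd ℝ),
    Matrix.det_fin_two]
  simp [LinearMap.toMatrix_apply]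

theorem ContinuousOn.measurableSet_inter_preimage {X Y : Type*} [TopologicalSpace X]
    [MeasurableSpace X] [BorelSpace X] [TopologicalSpace Y] [MeasurableSpace Y] [BorelSpace Y]
    {f : X → Y} {s : Set X} {t : Set Y} (hf : ContinuousOn f s) (hs : MeasurableSet s)
    (ht : MeasurableSet t) : MeasurableSet (s ∩ f ⁻¹' t) := by
  simpa only [domRestrict_eq, preimage_comp, Subtype.image_preimage_coe] using
    hs.subtype_image (hf.domRestrict.measurable ht)

section LocalDiffeo

variable {E : Type*} [NormedAddCommGroup E] [NormedSpace ℝ E] [FiniteDimensional ℝ E]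

theorem ContDiffAt.map_nhds_eq_of_det_ne_zero {f : E → E} {x : E} (hf : ContDiffAt ℝ 1 f x)
    (hdet : (fderiv ℝ f x).det ≠ 0) : map f (𝓝 x) = 𝓝 (f x) := by
  have := FiniteDimensional.complete ℝ E
  refine HasStrictFDerivAt.map_nhds_eq_of_equiv
    (f' := (fderiv ℝ f x).toContinuousLinearEquivOfDetNeZero hdet) ?_
  simpa using hf.hasStrictFDerivAt one_ne_zero

theorem image_mem_nhdsSet_of_det_ne_zero {f : E → E} {K W : Set E}
    (hf : ∀ x ∈ K, ContDiffAt ℝ 1 f x) (hdet : ∀ x ∈ K, (fderiv ℝ f x).det ≠ 0)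
    (hW : W ∈ 𝓝ˢ K) : f '' W ∈ 𝓝ˢ (f '' K) := by
  rw [mem_nhdsSet_iff_forall] at hW ⊢
  rintro _ ⟨x, hx, rfl⟩
  rw [← (hf x hx).map_nhds_eq_of_det_ne_zero (hdet x hx)]
  exact image_mem_map (hW x hx)

/-- A `C¹` map which is injective on a compact set and whose Jacobian there is `±1` almost
preserves the volume of small neighbourhoods of this compact set. -/
theorem exists_open_superset_volume_image_le [MeasurableSpace E] [BorelSpace E]
    (μ : Measure E) [μ.IsAddHaarMeasure] {f : E → E} {K : Set E} (hK : IsCompact K)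
    (hf : ∀ x ∈ K, ContDiffAt ℝ 1 f x) (hdet : ∀ x ∈ K, |(fderiv ℝ f x).det| = 1)
    (hinj : InjOn f K) {δ : ℝ} (hδ : 0 < δ) :
    ∃ U, IsOpen U ∧ K ⊆ U ∧ ContinuousOn f U ∧ ∀ s ⊆ U, MeasurableSet s →
      μ (f '' s) ≤ ENNReal.ofReal (1 + δ) * μ s ∧
        μ s ≤ ENNReal.ofReal (1 + δ) * μ (f '' s) := by
  have := FiniteDimensional.complete ℝ E
  have hdet0 : ∀ x ∈ K, (fderiv ℝ f x).det ≠ 0 := fun x hx h => by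
    simpa [h] using hdet x hx
  obtain ⟨V, hV, hVinj⟩ := hinj.exists_mem_nhdsSet hK (fun x hx => (hf x hx).continuousAt)
    fun x hx => by
      have hs : HasStrictFDerivAt f
          (((fderiv ℝ f x).toContinuousLinearEquivOfDetNeZero (hdet0 x hx) : E ≃L[ℝ] E) :
            E →L[ℝ] E) x := by
        simpa using (hf x hx).hasStrictFDerivAt one_ne_zero
      exact ⟨_, (hs.toOpenPartialHomeomorph f).open_source.mem_nhds
        hs.mem_toOpenPartialHomeomorph_source, (hs.toOpenPartialHomeomorph f).injOn⟩
  have hgood : {x | ContDiffAt ℝ 1 f x ∧ |(fderiv ℝ f x).det| < 1 + δ ∧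
      1 < (1 + δ) * |(fderiv ℝ f x).det|} ∈ 𝓝ˢ K := by
    refine mem_nhdsSet_iff_forall.2 fun x hx => ?_
    have hc : ContinuousAt (fun y => |(fderiv ℝ f y).det|) x :=
      (ContinuousLinearMap.continuous_det.continuousAt.comp
        ((hf x hx).fderiv_right (m := 0) (by norm_num)).continuousAt).abs
    refine ((hf x hx).eventually (by simp)).and ((hc.eventually_lt continuousAt_const ?_).and
      (continuousAt_const.eventually_lt (continuousAt_const.mul hc) ?_))
    · rw [hdet x hx]; linarith
    · rw [hdet x hx]; linarith
  obtain ⟨U, hUo, hKU, hU⟩ := mem_nhdsSet_iff_exists.1 (inter_mem hV hgood)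
  refine ⟨U, hUo, hKU, fun x hx => (hU hx).2.1.continuousAt.continuousWithinAt,
    fun s hs hsm => ?_⟩
  have hcv := lintegral_abs_det_fderiv_eq_addHaar_image μ hsm
    (fun x hx => ((hU (hs hx)).2.1.differentiableAt one_ne_zero).hasFDerivAt.hasFDerivWithinAt)
    (hVinj.mono fun x hx => (hU (hs hx)).1)
  rw [← hcv]
  constructor
  · rw [← setLIntegral_const]
    exact setLIntegral_mono measurable_const fun x hx =>
      ENNReal.ofReal_le_ofReal (hU (hs hx)).2.2.1.le
  · rw [← lintegral_const_mul' _ _ ENNReal.ofReal_ne_top, ← setLIntegral_one]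
    refine setLIntegral_mono' hsm fun x hx => ?_
    rw [← ENNReal.ofReal_mul (by linarith), ← ENNReal.ofReal_one]
    exact ENNReal.ofReal_le_ofReal (hU (hs hx)).2.2.2.le

end LocalDiffeo

/-- Comparison of the area between two level sets of `u` inside `S` with the area of the
corresponding rectangle, in terms of a tubular parametrisation `Ψ` of a neighbourhood of the
level set `u = h`. -/
theorem exists_volume_levels_bounds {u : ℝ × ℝ → ℝ} {S : Set (ℝ × ℝ)} {Ψ F : ℝ × ℝ → ℝ × ℝ}
    {τ h : ℝ} (hF : ∀ q, F q = (q.1, u (Ψ q) - h))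
    (hΨc : ∀ q ∈ Icc 0 τ ×ˢ {(0 : ℝ)}, ContDiffAt ℝ 1 Ψ q)
    (hFc : ∀ q ∈ Icc 0 τ ×ˢ {(0 : ℝ)}, ContDiffAt ℝ 1 F q)
    (hΨd : ∀ q ∈ Icc 0 τ ×ˢ {(0 : ℝ)}, |(fderiv ℝ Ψ q).det| = 1)
    (hFd : ∀ q ∈ Icc 0 τ ×ˢ {(0 : ℝ)}, |(fderiv ℝ F q).det| = 1)
    (hΨi : InjOn Ψ (Icc 0 τ ×ˢ {(0 : ℝ)}))
    (hlev : ∀ q ∈ Icc 0 τ ×ˢ {(0 : ℝ)}, u (Ψ q) = h)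
    (hint : ∀ q ∈ Ioo 0 τ ×ˢ {(0 : ℝ)}, S ∈ 𝓝 (Ψ q))
    (hnear : ∀ W ∈ 𝓝ˢ (Ψ '' (Icc 0 τ ×ˢ {(0 : ℝ)})), ∃ ε > 0, ∀ p ∈ S, |u p - h| < ε → p ∈ W)
    {δ : ℝ} (hδ : 0 < δ) :
    ∃ ε > 0, ∀ a b, h - ε < a → a ≤ b → b < h + ε →
      volume {p ∈ S | a ≤ u p ∧ u p < b} ≤
          ENNReal.ofReal ((1 + δ) ^ 2 * ((τ + 2 * δ) * (b - a))) ∧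
        ENNReal.ofReal ((τ - 2 * δ) * (b - a)) ≤
          ENNReal.ofReal ((1 + δ) ^ 2) * volume {p ∈ S | a ≤ u p ∧ u p < b} := by
  set K : Set (ℝ × ℝ) := Icc 0 τ ×ˢ {(0 : ℝ)}
  have hK : IsCompact K := isCompact_Icc.prod isCompact_singleton
  have hFK : ∀ q ∈ K, F q = q := fun q hq => by
    rw [hF, hlev q hq, sub_self]
    exact Prod.ext rfl hq.2.symm
  have hFi : InjOn F K := fun q hq q' hq' h => by rwa [hFK q hq, hFK q' hq'] at h
  have ne_of_abs : ∀ {x : ℝ}, |x| = 1 → x ≠ 0 := by rintro x hx rfl; simp at hx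
  obtain ⟨U₁, hU₁o, hKU₁, -, hU₁⟩ :=
    exists_open_superset_volume_image_le volume hK hΨc hΨd hΨi hδ
  obtain ⟨U₂, hU₂o, hKU₂, hFU₂, hU₂⟩ :=
    exists_open_superset_volume_image_le volume hK hFc hFd hFi hδ
  have hsq : ENNReal.ofReal (1 + δ) * ENNReal.ofReal (1 + δ) = ENNReal.ofReal ((1 + δ) ^ 2) := by
    rw [← ENNReal.ofReal_mul (by linarith), sq]
  set U : Set (ℝ × ℝ) := U₁ ∩ U₂ ∩ Ioo (-δ) (τ + δ) ×ˢ univ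
  have hUo : IsOpen U := (hU₁o.inter hU₂o).inter (isOpen_Ioo.prod isOpen_univ)
  have hKU : K ⊆ U := fun q hq => ⟨⟨hKU₁ hq, hKU₂ hq⟩,
    ⟨by linarith [hq.1.1], by linarith [hq.1.2]⟩, mem_univ _⟩
  have hUsub₁ : U ⊆ U₁ := fun q hq => hq.1.1
  have hUsub₂ : U ⊆ U₂ := fun q hq => hq.1.2
  have hFU : ContinuousOn F U := hFU₂.mono hUsub₂
  have hcompare : ∀ s ⊆ U, MeasurableSet s →
      volume (Ψ '' s) ≤ ENNReal.ofReal ((1 + δ) ^ 2) * volume (F '' s) ∧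
        volume (F '' s) ≤ ENNReal.ofReal ((1 + δ) ^ 2) * volume (Ψ '' s) := fun s hs hsm => by
    have h₁ := hU₁ s (hs.trans hUsub₁) hsm
    have h₂ := hU₂ s (hs.trans hUsub₂) hsm
    rw [← hsq, mul_assoc, mul_assoc]
    exact ⟨h₁.1.trans (mul_le_mul_right h₂.2 _), h₂.1.trans (mul_le_mul_right h₁.2 _)⟩
  obtain ⟨ε₁, hε₁, hnear₁⟩ := hnear _ (image_mem_nhdsSet_of_det_ne_zero hΨc
    (fun q hq => ne_of_abs (hΨd q hq)) (hUo.mem_nhdsSet.2 hKU))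
  set K' : Set (ℝ × ℝ) := Icc δ (τ - δ) ×ˢ {(0 : ℝ)}
  have hK'Ioo : K' ⊆ Ioo 0 τ ×ˢ {(0 : ℝ)} := fun q hq =>
    ⟨⟨by linarith [hq.1.1], by linarith [hq.1.2]⟩, hq.2⟩
  have hK'K : K' ⊆ K := fun q hq => ⟨Ioo_subset_Icc_self (hK'Ioo hq).1, hq.2⟩
  have hpre : U ∩ Ψ ⁻¹' S ∈ 𝓝ˢ K' := mem_nhdsSet_iff_forall.2 fun q hq =>
    inter_mem (hUo.mem_nhds (hKU (hK'K hq)))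
      ((hΨc q (hK'K hq)).continuousAt.preimage_mem_nhds (hint q (hK'Ioo hq)))
  obtain ⟨U', hU'o, hK'U', hU'⟩ := mem_nhdsSet_iff_exists.1 hpre
  have hbox : F '' U' ∈ 𝓝ˢ K' := by
    have := image_mem_nhdsSet_of_det_ne_zero (fun q hq => hFc q (hK'K hq))
      (fun q hq => ne_of_abs (hFd q (hK'K hq))) (hU'o.mem_nhdsSet.2 hK'U')
    rwa [(image_congr fun q hq => hFK q (hK'K hq) : F '' K' = (fun q => q) '' K'),
      image_id'] at this
  obtain ⟨N, hNo, hK'N, hN⟩ := mem_nhdsSet_iff_exists.1 hbox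
  obtain ⟨I, J, -, hJo, hI, hJ, hIJ⟩ :=
    generalized_tube_lemma isCompact_Icc isCompact_singleton hNo hK'N
  obtain ⟨ε₂, hε₂, hJε⟩ := Metric.isOpen_iff.1 hJo 0 (hJ rfl)
  refine ⟨min ε₁ ε₂, lt_min hε₁ hε₂, fun a b ha hab hb => ?_⟩
  have hmin₁ := min_le_left ε₁ ε₂
  have hmin₂ := min_le_right ε₁ ε₂
  have hslab : MeasurableSet ((univ : Set ℝ) ×ˢ Ico (a - h) (b - h)) :=
    MeasurableSet.univ.prod measurableSet_Ico
  constructor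
  · set s := U ∩ F ⁻¹' (univ ×ˢ Ico (a - h) (b - h))
    have hsm : MeasurableSet s := hFU.measurableSet_inter_preimage hUo.measurableSet hslab
    have hsub : {p ∈ S | a ≤ u p ∧ u p < b} ⊆ Ψ '' s := by
      rintro p ⟨hpS, hpa, hpb⟩
      obtain ⟨q, hq, rfl⟩ := hnear₁ p hpS (abs_lt.2 ⟨by linarith, by linarith⟩)
      refine ⟨q, ⟨hq, mem_univ _, ?_⟩, rfl⟩
      rw [hF]
      exact ⟨by simpa using hpa, by simpa using hpb⟩
    have hFs : F '' s ⊆ Ioo (-δ) (τ + δ) ×ˢ Ico (a - h) (b - h) := by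
      rintro _ ⟨q, ⟨hqU, -, hq⟩, rfl⟩
      refine ⟨?_, hq⟩
      rw [hF]
      exact hqU.2.1
    calc _ ≤ volume (Ψ '' s) := measure_mono hsub
      _ ≤ _ := (hcompare s inter_subset_left hsm).1
      _ ≤ ENNReal.ofReal ((1 + δ) ^ 2) *
          volume (Ioo (-δ) (τ + δ) ×ˢ Ico (a - h) (b - h)) := by gcongr
      _ = _ := by
        rw [Measure.volume_eq_prod, Measure.prod_prod, Real.volume_Ioo, Real.volume_Ico,
          ENNReal.ofReal_mul (by positivity), ENNReal.ofReal_mul' (by linarith)]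
        ring_nf
  · set s := U' ∩ F ⁻¹' (Icc δ (τ - δ) ×ˢ Ico (a - h) (b - h))
    have hU'U : U' ⊆ U := fun q hq => (hU' hq).1
    have hsm : MeasurableSet s := (hFU.mono hU'U).measurableSet_inter_preimage
      hU'o.measurableSet (measurableSet_Icc.prod measurableSet_Ico)
    have hFs : Icc δ (τ - δ) ×ˢ Ico (a - h) (b - h) ⊆ F '' s := by
      rintro ⟨t, r⟩ ⟨ht, hr⟩
      have hrJ : r ∈ J := hJε (by
        rw [Metric.mem_ball, Real.dist_eq, sub_zero, abs_lt]
        constructor <;> linarith [hr.1, hr.2])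
      obtain ⟨q, hq, hqe⟩ := hN (hIJ ⟨hI ht, hrJ⟩)
      exact ⟨q, ⟨hq, by rw [mem_preimage, hqe]; exact ⟨ht, hr⟩⟩, hqe⟩
    have hsub : Ψ '' s ⊆ {p ∈ S | a ≤ u p ∧ u p < b} := by
      rintro _ ⟨q, ⟨hqU, -, hq⟩, rfl⟩
      rw [hF] at hq
      exact ⟨(hU' hqU).2, by simpa using hq.1, by simpa using hq.2⟩
    calc ENNReal.ofReal ((τ - 2 * δ) * (b - a))
        = volume (Icc δ (τ - δ) ×ˢ Ico (a - h) (b - h)) := by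
          rw [Measure.volume_eq_prod, Measure.prod_prod, Real.volume_Icc, Real.volume_Ico,
            ENNReal.ofReal_mul' (by linarith)]
          ring_nf
      _ ≤ volume (F '' s) := measure_mono hFs
      _ ≤ _ := (hcompare s (inter_subset_left.trans hU'U) hsm).2
      _ ≤ _ := by gcongr

theorem hasDerivAt_volume_sublevel {α : Type*} [MeasurableSpace α] {μ : Measure α} {u : α → ℝ}
    {S : Set α} {τ h : ℝ} (hτ : 0 ≤ τ) (hfin : μ S ≠ ⊤)
    (hmeas : ∀ᶠ a in 𝓝 h, ∀ b, MeasurableSet {p ∈ S | a ≤ u p ∧ u p < b})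
    (hbd : ∀ δ > 0, ∃ ε > 0, ∀ a b, h - ε < a → a ≤ b → b < h + ε →
      μ {p ∈ S | a ≤ u p ∧ u p < b} ≤
          ENNReal.ofReal ((1 + δ) ^ 2 * ((τ + 2 * δ) * (b - a))) ∧
        ENNReal.ofReal ((τ - 2 * δ) * (b - a)) ≤
          ENNReal.ofReal ((1 + δ) ^ 2) * μ {p ∈ S | a ≤ u p ∧ u p < b}) :
    HasDerivAt (fun x : ℝ => (μ {p ∈ S | u p < x}).toReal) τ h := by
  rw [hasDerivAt_iff_isLittleO, Asymptotics.isLittleO_iff]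
  intro c hc
  have hup : ∀ᶠ δ : ℝ in 𝓝 0, (1 + δ) ^ 2 * (τ + 2 * δ) < τ + c :=
    ContinuousAt.eventually_lt (by fun_prop) continuousAt_const (by simpa using hc)
  have hlow : ∀ᶠ δ : ℝ in 𝓝 0, (1 + δ) ^ 2 * (τ - c) < τ - 2 * δ :=
    ContinuousAt.eventually_lt (by fun_prop) (by fun_prop) (by simpa using hc)
  obtain ⟨δ, ⟨hδ₁, hδ₂⟩, hδ⟩ := (((hup.and hlow).filter_mono nhdsWithin_le_nhds).and
    (self_mem_nhdsWithin : Ioi (0 : ℝ) ∈ 𝓝[>] 0)).exists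
  replace hδ : 0 < δ := hδ
  obtain ⟨ε, hε, hbd⟩ := hbd δ hδ
  obtain ⟨ε', hε', hmeas⟩ := Metric.eventually_nhds_iff.1 hmeas
  have hfin' : ∀ P : α → Prop, μ {p ∈ S | P p} ≠ ⊤ := fun P =>
    measure_ne_top_of_subset (fun p hp => hp.1) hfin
  have key : ∀ a b, dist a h < ε' → h - ε < a → a ≤ b → b < h + ε →
      |(μ {p ∈ S | u p < b}).toReal - (μ {p ∈ S | u p < a}).toReal - (b - a) * τ| ≤
        c * (b - a) := by
    intro a b ha' ha hab hb
    have hsplit : {p ∈ S | u p < b} =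
        {p ∈ S | u p < a} ∪ {p ∈ S | a ≤ u p ∧ u p < b} := by
      ext p
      simp only [mem_ofPred_eq, mem_union]
      constructor
      · rintro ⟨hp, hpb⟩
        rcases lt_or_ge (u p) a with hpa | hpa
        exacts [Or.inl ⟨hp, hpa⟩, Or.inr ⟨hp, hpa, hpb⟩]
      · rintro (⟨hp, hpa⟩ | ⟨hp, -, hpb⟩)
        exacts [⟨hp, hpa.trans_le hab⟩, ⟨hp, hpb⟩]
    have hdisj : Disjoint {p ∈ S | u p < a} {p ∈ S | a ≤ u p ∧ u p < b} :=
      disjoint_left.2 fun p hp hp' => hp.2.not_ge hp'.2.1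
    rw [hsplit, measure_union hdisj (hmeas ha' b), ENNReal.toReal_add (hfin' _) (hfin' _)]
    obtain ⟨h₁, h₂⟩ := hbd a b ha hab hb
    set r := (μ {p ∈ S | a ≤ u p ∧ u p < b}).toReal
    have hba : 0 ≤ b - a := sub_nonneg.2 hab
    have hr₁ : r ≤ (1 + δ) ^ 2 * ((τ + 2 * δ) * (b - a)) :=
      ENNReal.toReal_le_of_le_ofReal (by positivity) h₁
    have hr₂ : (τ - 2 * δ) * (b - a) ≤ (1 + δ) ^ 2 * r := by
      rw [← ENNReal.ofReal_toReal (hfin' _), ← ENNReal.ofReal_mul (by positivity)] at h₂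
      exact (ENNReal.ofReal_le_ofReal_iff (by positivity)).1 h₂
    have hr₃ : (τ - c) * (b - a) ≤ r := by
      refine le_of_mul_le_mul_left ?_ (by positivity : 0 < (1 + δ) ^ 2)
      nlinarith [mul_le_mul_of_nonneg_right hδ₂.le hba]
    rw [abs_le]
    constructor <;> nlinarith [mul_le_mul_of_nonneg_right hδ₁.le hba]
  filter_upwards [Metric.ball_mem_nhds h (lt_min hε hε')] with x hx
  rw [Metric.mem_ball, lt_min_iff] at hx
  obtain ⟨hx₁, hx₂⟩ := abs_lt.1 (Real.dist_eq x h ▸ hx.1)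
  rw [Real.norm_eq_abs, Real.norm_eq_abs, smul_eq_mul]
  rcases le_total h x with hhx | hxh
  · rw [abs_of_nonneg (sub_nonneg.2 hhx)]
    exact key h x (by simpa using hε') (by linarith) hhx (by linarith)
  · rw [abs_of_nonpos (sub_nonpos.2 hxh), neg_sub, ← abs_neg]
    convert key x h hx.2 (by linarith) hxh (by linarith) using 2
    ring

theorem Function.Periodic.deriv_eq_zero_or_exists_deriv_ne_zero {g : ℝ → ℝ} {T : ℝ}
    (hT : 0 < T) (hp : Function.Periodic g T) (hg : AnalyticOnNhd ℝ g univ) :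
    (∀ x, deriv g x = 0) ∨ ∃ ε > 0, ∀ x, 0 < |g x| → |g x| < ε → deriv g x ≠ 0 := by
  set Z : Set ℝ := {x ∈ Icc 0 T | deriv g x = 0}
  rcases Z.finite_or_infinite with hZ | hZ
  · right
    have hfin : ((fun x => |g x|) '' Z \ {0}).Finite := (hZ.image _).subset sdiff_subset
    obtain ⟨ε, hε, hball⟩ := Metric.isOpen_iff.1 hfin.isClosed.isOpen_compl 0 (by simp)
    refine ⟨ε, hε, fun x hx₀ hxε hx => ?_⟩
    have hp' : Function.Periodic (fun x => (g x, deriv g x)) T := fun x => by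
      have hd : deriv g (x + T) = deriv g x := by
        rw [← deriv_comp_add_const, show (fun x => g (x + T)) = g from funext hp]
      simp only [hp x, hd]
    obtain ⟨y, hy, hxy⟩ := hp'.exists_mem_Ico₀ hT x
    rw [Prod.mk.injEq] at hxy
    refine hball (a := |g x|) (by simpa using hxε) ⟨⟨y, ⟨Ico_subset_Icc_self hy, ?_⟩, ?_⟩, hx₀.ne'⟩
    · rw [← hxy.2, hx]
    · simp only [hxy.1]
  · left
    obtain ⟨x, -, hx⟩ := hZ.exists_accPt_of_subset_isCompact isCompact_Icc (sep_subset _ _)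
    have hfreq : ∃ᶠ z in 𝓝[≠] x, deriv g z = 0 :=
      (accPt_iff_frequently_nhdsNE.1 hx).mono fun z hz => hz.2
    exact fun y => hg.deriv.eqOn_zero_of_preconnected_of_frequently_eq_zero
      isPreconnected_univ (mem_univ x) hfreq (mem_univ y)

theorem closure_inter_subset_connectedComponentIn {X : Type*} [TopologicalSpace X] {F : Set X}
    {x : X} (hx : x ∈ F) :
    closure (connectedComponentIn F x) ∩ F ⊆ connectedComponentIn F x := by
  have hsub := connectedComponentIn_subset F x
  refine IsPreconnected.subset_connectedComponentIn
    (isPreconnected_connectedComponentIn.subset_closure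
      (fun y hy => ⟨subset_closure hy, hsub hy⟩) inter_subset_left)
    ⟨subset_closure (mem_connectedComponentIn hx), hx⟩ inter_subset_right

theorem norm_le_of_mem_euclBall {ρ : ℝ} {p : ℝ × ℝ} (hp : p ∈ euclBall ρ) : ‖p‖ ≤ |ρ| := by
  have hp' : p.1 ^ 2 + p.2 ^ 2 ≤ ρ ^ 2 := hp
  rw [Prod.norm_def, max_le_iff, Real.norm_eq_abs, Real.norm_eq_abs]
  exact ⟨sq_le_sq.1 (by nlinarith), sq_le_sq.1 (by nlinarith)⟩

theorem isCompact_euclBall (ρ : ℝ) : IsCompact (euclBall ρ) :=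
  Metric.isCompact_of_isClosed_isBounded (isClosed_le (by fun_prop) (by fun_prop))
    ((Metric.isBounded_closedBall (x := (0 : ℝ × ℝ)) (r := |ρ|)).subset fun _ hp =>
      mem_closedBall_zero_iff.2 (norm_le_of_mem_euclBall hp))

theorem isCompact_sector_superlevel {H : ℝ × ℝ → ℝ} {ρ : ℝ} {x₀ : ℝ × ℝ}
    (hx₀ : x₀ ∈ {p ∈ euclBall ρ | H p ≠ 0}) (hH : ContinuousOn H (euclBall ρ)) {a : ℝ}
    (ha : 0 < a) : IsCompact {p ∈ sector H ρ x₀ | a ≤ |H p|} := by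
  have hcl : IsClosed (closure (sector H ρ x₀) ∩ (euclBall ρ ∩ (fun p => |H p|) ⁻¹' Ici a)) :=
    isClosed_closure.inter (hH.abs.preimage_isClosed_of_isClosed
      (isCompact_euclBall ρ).isClosed isClosed_Ici)
  convert (isCompact_euclBall ρ).of_isClosed_subset hcl fun p hp => hp.2.1 using 1
  ext p
  constructor
  · exact fun hp => ⟨subset_closure hp.1, (connectedComponentIn_subset _ _ hp.1).1, hp.2⟩
  · rintro ⟨hp, hpρ, hpa⟩
    exact ⟨closure_inter_subset_connectedComponentIn hx₀
      ⟨hp, hpρ, abs_pos.1 (ha.trans_le hpa)⟩, hpa⟩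

/-- A curve which is continuously differentiable on a compact interval, including at its
endpoints, extends to a `C¹` curve on the whole line. -/
theorem exists_contDiff_one_extension {E : Type*} [NormedAddCommGroup E] [NormedSpace ℝ E]
    [CompleteSpace E] {γ v : ℝ → E} {τ : ℝ} (hτ : 0 ≤ τ)
    (hγ : ∀ t ∈ Icc 0 τ, HasDerivAt γ (v t) t) (hv : ContinuousOn v (Icc 0 τ)) :
    ∃ η : ℝ → E, ContDiff ℝ 1 η ∧ (∀ t ∈ Icc 0 τ, η t = γ t) ∧
      ∀ t ∈ Icc 0 τ, HasDerivAt η (v t) t := by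
  set w : ℝ → E := IccExtend hτ (domRestrict (Icc 0 τ) v)
  have hw : Continuous w := hv.domRestrict.Icc_extend'
  have hwv : ∀ t ∈ Icc 0 τ, w t = v t := fun t ht => IccExtend_of_mem hτ _ ht
  have hd : ∀ t, HasDerivAt (fun t => γ 0 + ∫ s in (0)..t, w s) (w t) t := fun t =>
    (hw.integral_hasStrictDerivAt 0 t).hasDerivAt.const_add _
  refine ⟨fun t => γ 0 + ∫ s in (0)..t, w s, ?_, fun t ht => ?_, fun t ht => hwv t ht ▸ hd t⟩
  · rw [contDiff_one_iff_deriv]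
    exact ⟨fun t => (hd t).differentiableAt, by rwa [funext fun t => (hd t).deriv]⟩
  · have : ∀ s ∈ uIcc 0 t, HasDerivAt γ (w s) s := fun s hs => by
      rw [uIcc_of_le ht.1] at hs
      have hs' : s ∈ Icc 0 τ := ⟨hs.1, hs.2.trans ht.2⟩
      exact hwv s hs' ▸ hγ s hs'
    simp only [intervalIntegral.integral_eq_sub_of_hasDerivAt this (hw.intervalIntegrable _ _)]
    abel

theorem fderiv_apply_prod (H : ℝ × ℝ → ℝ) (p v : ℝ × ℝ) :
    fderiv ℝ H p v = v.1 * fderiv ℝ H p (1, 0) + v.2 * fderiv ℝ H p (0, 1) := by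
  conv_lhs => rw [show v = v.1 • ((1 : ℝ), (0 : ℝ)) + v.2 • ((0 : ℝ), (1 : ℝ)) by ext <;> simp]
  rw [map_add, map_smul, map_smul, smul_eq_mul, smul_eq_mul]

/-- The gradient of `H` divided by its squared norm. -/
noncomputable def normalizedGradient (H : ℝ × ℝ → ℝ) (p : ℝ × ℝ) : ℝ × ℝ :=
  ((fderiv ℝ H p (1, 0)) ^ 2 + (fderiv ℝ H p (0, 1)) ^ 2)⁻¹ •
    (fderiv ℝ H p (1, 0), fderiv ℝ H p (0, 1))

section NormalizedGradient

variable {H : ℝ × ℝ → ℝ} {p : ℝ × ℝ}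

theorem sq_fderiv_add_sq_fderiv_ne_zero (hp : fderiv ℝ H p ≠ 0) :
    (fderiv ℝ H p (1, 0)) ^ 2 + (fderiv ℝ H p (0, 1)) ^ 2 ≠ 0 := by
  contrapose! hp
  ext
  · have : fderiv ℝ H p (1, 0) = 0 := by nlinarith
    simpa using this
  · have : fderiv ℝ H p (0, 1) = 0 := by nlinarith
    simpa using this

theorem fderiv_normalizedGradient (hp : fderiv ℝ H p ≠ 0) :
    fderiv ℝ H p (normalizedGradient H p) = 1 := by
  rw [fderiv_apply_prod]
  have := sq_fderiv_add_sq_fderiv_ne_zero hp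
  simp only [normalizedGradient, Prod.smul_mk, smul_eq_mul]
  field_simp

theorem ContDiffAt.normalizedGradient (hH : ContDiffAt ℝ 2 H p) (hp : fderiv ℝ H p ≠ 0) :
    ContDiffAt ℝ 1 (normalizedGradient H) p := by
  have hd : ContDiffAt ℝ 1 (fderiv ℝ H) p := hH.fderiv_right (by norm_num)
  have hx := hd.clm_apply (contDiffAt_const (c := ((1 : ℝ), (0 : ℝ))))
  have hy := hd.clm_apply (contDiffAt_const (c := ((0 : ℝ), (1 : ℝ))))
  exact (((hx.pow 2).add (hy.pow 2)).inv (sq_fderiv_add_sq_fderiv_ne_zero hp)).smul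
    (hx.prodMk hy)

end NormalizedGradient

theorem exists_tubular_parametrization {H : ℝ × ℝ → ℝ} {γ : ℝ → ℝ × ℝ} {τ : ℝ} (hτ : 0 ≤ τ)
    (hγ : ∀ t ∈ Icc 0 τ, HasDerivAt γ (hamVF H (γ t)) t)
    (hH : ∀ t ∈ Icc 0 τ, ContDiffAt ℝ 2 H (γ t)) (hcrit : ∀ t ∈ Icc 0 τ, fderiv ℝ H (γ t) ≠ 0)
    (h0 : ∀ t ∈ Icc 0 τ, H (γ t) ≠ 0) (h : ℝ) :
    ∃ Ψ : ℝ × ℝ → ℝ × ℝ, ∀ t ∈ Icc 0 τ, Ψ (t, 0) = γ t ∧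
      (ContDiffAt ℝ 1 Ψ (t, 0) ∧ |(fderiv ℝ Ψ (t, 0)).det| = 1) ∧
      ContDiffAt ℝ 1 (fun q => (q.1, |H (Ψ q)| - h)) (t, 0) ∧
        |(fderiv ℝ (fun q => (q.1, |H (Ψ q)| - h)) (t, 0)).det| = 1 := by
  have hv : ContinuousOn (fun t => hamVF H (γ t)) (Icc 0 τ) := fun t ht => by
    have hd : ContinuousAt (fderiv ℝ H) (γ t) :=
      ((hH t ht).fderiv_right (m := 0) (by norm_num)).continuousAt
    have hd' := ContinuousAt.comp (f := γ) hd (hγ t ht).continuousAt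
    exact ((hd'.clm_apply continuousAt_const).prodMk
      (hd'.clm_apply continuousAt_const).neg).continuousWithinAt
  obtain ⟨η, hη, hηγ, hηd⟩ := exists_contDiff_one_extension hτ hγ hv
  set Ψ : ℝ × ℝ → ℝ × ℝ := fun q => η q.1 + q.2 • normalizedGradient H (η q.1) with hΨ
  refine ⟨Ψ, fun t ht => ?_⟩
  have hΨt : Ψ (t, 0) = γ t := by simp [hΨ, hηγ t ht]
  have hgr : ContDiffAt ℝ 1 (fun q : ℝ × ℝ => normalizedGradient H (η q.1)) (t, 0) := by
    refine ContDiffAt.comp (g := normalizedGradient H) (f := fun q : ℝ × ℝ => η q.1) (t, 0) ?_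
      (hη.comp contDiff_fst).contDiffAt
    simp only [hηγ t ht]
    exact (hH t ht).normalizedGradient (hcrit t ht)
  have hΨc : ContDiffAt ℝ 1 Ψ (t, 0) :=
    (hη.comp contDiff_fst).contDiffAt.add (contDiffAt_snd.smul hgr)
  have hΨf : HasFDerivAt Ψ (fderiv ℝ Ψ (t, 0)) (t, 0) :=
    (hΨc.differentiableAt one_ne_zero).hasFDerivAt
  have hη' : HasFDerivAt (fun q : ℝ × ℝ => η q.1)
      ((ContinuousLinearMap.toSpanSingleton ℝ (hamVF H (γ t))).comp
        (ContinuousLinearMap.fst ℝ ℝ ℝ)) (t, 0) :=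
    HasFDerivAt.comp (g := η) (t, 0) (hηd t ht).hasFDerivAt hasFDerivAt_fst
  have hΨd : fderiv ℝ Ψ (t, 0) = _ := (hη'.add
    (hasFDerivAt_snd.smul (hgr.differentiableAt one_ne_zero).hasFDerivAt)).fderiv
  have hΨx : fderiv ℝ Ψ (t, 0) (1, 0) = hamVF H (γ t) := by
    rw [hΨd]; simp
  have hΨy : fderiv ℝ Ψ (t, 0) (0, 1) = normalizedGradient H (γ t) := by
    rw [hΨd]; simp [hηγ t ht]
  have hdN := fderiv_normalizedGradient (hcrit t ht)
  refine ⟨hΨt, ⟨hΨc, ?_⟩, ?_⟩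
  · rw [ContinuousLinearMap.det_real_prod, hΨx, hΨy]
    rw [fderiv_apply_prod] at hdN
    simp only [hamVF]
    rw [show ∀ a b c d : ℝ, a * b - c * -d = c * d + b * a by intros; ring, hdN, abs_one]
  · have hHΨ : HasFDerivAt (fun q => H (Ψ q)) ((fderiv ℝ H (γ t)).comp (fderiv ℝ Ψ (t, 0)))
        (t, 0) := by
      refine HasFDerivAt.comp (t, 0) ?_ hΨf
      rw [hΨt]
      exact ((hH t ht).differentiableAt two_ne_zero).hasFDerivAt
    have hne : H (Ψ (t, 0)) ≠ 0 := by rw [hΨt]; exact h0 t ht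
    have hHc : ContDiffAt ℝ 1 (fun q => |H (Ψ q)|) (t, 0) := by
      refine ContDiffAt.comp (g := fun x : ℝ => |x|) (f := fun q => H (Ψ q)) (t, 0)
        (contDiffAt_abs (n := 1) hne) ?_
      refine ContDiffAt.comp (g := H) (t, 0) ?_ hΨc
      rw [hΨt]
      exact (hH t ht).of_le (by norm_num)
    refine ⟨contDiffAt_fst.prodMk (hHc.sub contDiffAt_const), ?_⟩
    have hF : HasFDerivAt (fun q => (q.1, |H (Ψ q)| - h)) _ (t, 0) :=
      (hasFDerivAt_fst (𝕜 := ℝ) (p := ((t, 0) : ℝ × ℝ))).prodMk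
      (HasFDerivAt.sub_const h (f := fun q => |H (Ψ q)|)
          (HasDerivAt.comp_hasFDerivAt (h₂ := fun x : ℝ => |x|) (t, 0) (hasDerivAt_abs hne) hHΨ))
    have hsign : |((SignType.sign (H (Ψ (t, 0))) : SignType) : ℝ)| = 1 := by
      rcases lt_or_gt_of_ne hne with hlt | hgt
      · simp [sign_neg hlt]
      · simp [sign_pos hgt]
    rw [hF.fderiv, ContinuousLinearMap.det_real_prod]
    simp [hΨy, hdN, hsign]

theorem euclBall_subset_ball {ρ r : ℝ} (hρ : 0 ≤ ρ) (hr : ρ < r) :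
    euclBall ρ ⊆ Metric.ball 0 r := fun p hp =>
  mem_ball_zero_iff.2 ((norm_le_of_mem_euclBall hp).trans_lt (by rwa [abs_of_nonneg hρ]))

theorem exists_near_level_subset {X : Type*} [TopologicalSpace X] {S W : Set X} {u : X → ℝ}
    {h : ℝ} (hh : 0 < h) (hS : ∀ a > 0, IsCompact {p ∈ S | a ≤ u p}) (hu : ContinuousOn u S)
    (hW : W ∈ 𝓝ˢ {p ∈ S | u p = h}) : ∃ ε > 0, ∀ p ∈ S, |u p - h| < ε → p ∈ W := by
  obtain ⟨V, hVo, hV, hVW⟩ := mem_nhdsSet_iff_exists.1 hW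
  have hC : IsCompact ({p ∈ S | h / 2 ≤ u p} \ V) := (hS _ (half_pos hh)).diff hVo
  obtain ⟨ε, hε, hεC⟩ := hC.exists_forall_le' (f := fun p => |u p - h|)
    (((hu.mono fun p hp => hp.1.1).sub continuousOn_const).abs) (a := 0)
    fun p hp => abs_pos.2 (sub_ne_zero.2 fun hph => hp.2 (hV ⟨hp.1.1, hph⟩))
  refine ⟨min ε (h / 2), lt_min hε (half_pos hh), fun p hp hpε => ?_⟩
  rw [lt_min_iff] at hpε
  by_contra hpW
  exact (hεC p ⟨⟨hp, by linarith [(abs_lt.1 hpε.2).1]⟩, fun hpV => hpW (hVW hpV)⟩).not_gt hpε.1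

theorem const_on_circle_or_exists_transverse {H : ℝ × ℝ → ℝ} {ρ : ℝ} (hρ : 0 < ρ)
    (hH : ∀ p ∈ euclBall ρ, AnalyticAt ℝ H p) :
    (∃ c, ∀ p : ℝ × ℝ, p.1 ^ 2 + p.2 ^ 2 = ρ ^ 2 → H p = c) ∨
      ∃ ε > 0, ∀ p : ℝ × ℝ, p.1 ^ 2 + p.2 ^ 2 = ρ ^ 2 → 0 < |H p| → |H p| < ε →
        p.1 * fderiv ℝ H p (0, 1) - p.2 * fderiv ℝ H p (1, 0) ≠ 0 := by
  set σ : ℝ → ℝ × ℝ := fun θ => (ρ * Real.cos θ, ρ * Real.sin θ) with hσ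
  have hσmem : ∀ θ, σ θ ∈ euclBall ρ := fun θ => by
    change (ρ * Real.cos θ) ^ 2 + (ρ * Real.sin θ) ^ 2 ≤ ρ ^ 2
    nlinarith [Real.sin_sq_add_cos_sq θ]
  have hsurj : ∀ p : ℝ × ℝ, p.1 ^ 2 + p.2 ^ 2 = ρ ^ 2 → ∃ θ, σ θ = p := fun p hp => by
    have hnorm : ‖(⟨p.1, p.2⟩ : ℂ)‖ = ρ := by
      rw [Complex.norm_eq_sqrt_sq_add_sq, hp, Real.sqrt_sq hρ.le]
    refine ⟨Complex.arg ⟨p.1, p.2⟩, ?_⟩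
    rw [hσ, ← hnorm]
    exact Prod.ext (Complex.norm_mul_cos_arg _) (Complex.norm_mul_sin_arg _)
  have hσan : AnalyticOnNhd ℝ σ univ := fun θ _ =>
    (analyticAt_const.mul (Real.analyticAt_cos)).prod
      (analyticAt_const.mul (Real.analyticAt_sin))
  have hg : AnalyticOnNhd ℝ (fun θ => H (σ θ)) univ := fun θ hθ =>
    (hH _ (hσmem θ)).comp (hσan θ hθ)
  have hper : Function.Periodic (fun θ => H (σ θ)) (2 * Real.pi) := fun θ => by simp [hσ]
  rcases hper.deriv_eq_zero_or_exists_deriv_ne_zero Real.two_pi_pos hg with hd | ⟨ε, hε, hd⟩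
  · refine Or.inl ⟨H (σ 0), fun p hp => ?_⟩
    obtain ⟨θ, rfl⟩ := hsurj p hp
    exact is_const_of_deriv_eq_zero (fun θ => (hg θ (mem_univ _)).differentiableAt) hd θ 0
  · refine Or.inr ⟨ε, hε, fun p hp hp₀ hpε => ?_⟩
    obtain ⟨θ, rfl⟩ := hsurj p hp
    have hσd : HasDerivAt σ (ρ * -Real.sin θ, ρ * Real.cos θ) θ :=
      ((Real.hasDerivAt_cos θ).const_mul ρ).prodMk ((Real.hasDerivAt_sin θ).const_mul ρ)
    have hder := ((hH _ (hσmem θ)).differentiableAt.hasFDerivAt.comp_hasDerivAt θ hσd).deriv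
    have hne := hd θ hp₀ hpε
    rw [show (fun θ => H (σ θ)) = H ∘ σ from rfl, hder, fderiv_apply_prod] at hne
    convert hne using 1
    simp only [hσ]
    ring

/-- The derivative of the sublevel-set area is the passage time: for all sufficiently
small `ρ > 0`, every separatrix sector `S_ρ` of `B_ρ ∖ {H = 0}`, and any family of
injective trajectories `γ h : [0, τ h] → ℝ²` of the Hamiltonian vector field whose
images are the level sets `{p ∈ S_ρ : |H p| = h}` with endpoints on `∂B_ρ`, the area
`A(h)` of `{p ∈ S_ρ : |H p| < h}` is differentiable with `A'(h) = τ h` for all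
sufficiently small `h > 0`. -/
theorem area_derivative_is_passage_time (H : ℝ × ℝ → ℝ)
    (hH : AnalyticAt ℝ H 0) (h0 : H 0 = 0) (hcrit : fderiv ℝ H 0 = 0)
    (hiso : ∀ᶠ p in nhds (0 : ℝ × ℝ), fderiv ℝ H p = 0 → p = 0)
    (hmax : ¬ IsLocalMax H 0) (hmin : ¬ IsLocalMin H 0) :
    ∃ ρ₀ > (0 : ℝ), ∀ ρ : ℝ, 0 < ρ → ρ < ρ₀ →
      ∀ x₀ ∈ {p ∈ euclBall ρ | H p ≠ 0},
        ∀ (τ : ℝ → ℝ) (γ : ℝ → ℝ → ℝ × ℝ) (h₁ : ℝ), 0 < h₁ →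
          (∀ h ∈ Set.Ioo (0 : ℝ) h₁,
            0 < τ h ∧
            (∀ t ∈ Set.Icc 0 (τ h), HasDerivAt (γ h) (hamVF H (γ h t)) t) ∧
            Set.InjOn (γ h) (Set.Icc 0 (τ h)) ∧
            γ h '' Set.Icc 0 (τ h) = {p ∈ sector H ρ x₀ | |H p| = h} ∧
            (γ h 0).1 ^ 2 + (γ h 0).2 ^ 2 = ρ ^ 2 ∧
            (γ h (τ h)).1 ^ 2 + (γ h (τ h)).2 ^ 2 = ρ ^ 2) →
          ∃ h₂ > (0 : ℝ), ∀ h ∈ Set.Ioo (0 : ℝ) h₂,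
            HasDerivAt
              (fun h' : ℝ =>
                (MeasureTheory.volume {p ∈ sector H ρ x₀ | |H p| < h'}).toReal)
              (τ h) h := by
  obtain ⟨ρ₀, hρ₀, hball⟩ := Metric.eventually_nhds_iff_ball.1
    (hH.eventually_analyticAt.and hiso)
  refine ⟨ρ₀, hρ₀, fun ρ hρ hρρ₀ x₀ hx₀ τ γ h₁ hh₁ hγ => ?_⟩
  have hsub : euclBall ρ ⊆ Metric.ball 0 ρ₀ := euclBall_subset_ball hρ.le hρρ₀
  have hHan : ∀ p ∈ euclBall ρ, AnalyticAt ℝ H p := fun p hp => (hball p (hsub hp)).1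
  have hHcont : ContinuousOn H (euclBall ρ) := fun p hp =>
    (hHan p hp).continuousAt.continuousWithinAt
  have hsec : ∀ p ∈ sector H ρ x₀, p ∈ euclBall ρ ∧ H p ≠ 0 := fun p hp =>
    connectedComponentIn_subset {p ∈ euclBall ρ | H p ≠ 0} x₀ hp
  have hγmem : ∀ h ∈ Ioo (0 : ℝ) h₁, ∀ t ∈ Icc 0 (τ h),
      γ h t ∈ sector H ρ x₀ ∧ |H (γ h t)| = h := fun h hh t ht => by
    have := mem_image_of_mem (γ h) ht
    rwa [(hγ h hh).2.2.2.1] at this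
  rcases const_on_circle_or_exists_transverse hρ hHan with ⟨c, hc⟩ | ⟨ε, hε, htrans⟩
  · have hlev : ∀ h ∈ Ioo (0 : ℝ) h₁, |c| = h := fun h hh => by
      rw [← hc _ (hγ h hh).2.2.2.2.1]
      exact (hγmem h hh 0 ⟨le_rfl, (hγ h hh).1.le⟩).2
    have h₂ := hlev (h₁ / 2) ⟨by linarith, by linarith⟩
    have h₃ := hlev (h₁ / 3) ⟨by linarith, by linarith⟩
    linarith
  refine ⟨min h₁ ε, lt_min hh₁ hε, fun h hh => ?_⟩
  have hhε : h < ε := hh.2.trans_le (min_le_right _ _)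
  have hh' : h ∈ Ioo (0 : ℝ) h₁ := ⟨hh.1, hh.2.trans_le (min_le_left _ _)⟩
  obtain ⟨hτ, hode, hinj, himg, -, -⟩ := hγ h hh'
  replace hγmem := hγmem h hh'
  have hγball : ∀ t ∈ Icc 0 (τ h), γ h t ∈ euclBall ρ := fun t ht => (hsec _ (hγmem t ht).1).1
  have hγ0 : ∀ t ∈ Icc 0 (τ h), H (γ h t) ≠ 0 := fun t ht => (hsec _ (hγmem t ht).1).2
  have hγcrit : ∀ t ∈ Icc 0 (τ h), fderiv ℝ H (γ h t) ≠ 0 := fun t ht hcr =>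
    hγ0 t ht (by rw [(hball _ (hsub (hγball t ht))).2 hcr, h0])
  obtain ⟨Ψ, hΨ⟩ := exists_tubular_parametrization hτ.le hode
    (fun t ht => (hHan _ (hγball t ht)).contDiffAt) hγcrit hγ0 h
  have hΨ' : ∀ q ∈ Icc 0 (τ h) ×ˢ {(0 : ℝ)}, q = (q.1, 0) ∧ q.1 ∈ Icc 0 (τ h) :=
    fun q hq => ⟨Prod.ext rfl hq.2, hq.1⟩
  have hΨγ : ∀ q ∈ Icc 0 (τ h) ×ˢ {(0 : ℝ)}, Ψ q = γ h q.1 := fun q hq => by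
    conv_lhs => rw [(hΨ' q hq).1]
    exact (hΨ q.1 hq.1).1
  have hΨimg : Ψ '' (Icc 0 (τ h) ×ˢ {(0 : ℝ)}) = {p ∈ sector H ρ x₀ | |H p| = h} := by
    rw [← himg]
    ext p
    constructor
    · rintro ⟨q, hq, rfl⟩
      exact ⟨q.1, hq.1, (hΨγ q hq).symm⟩
    · rintro ⟨t, ht, rfl⟩
      exact ⟨(t, 0), ⟨ht, rfl⟩, (hΨ t ht).1⟩
  have hint : ∀ t ∈ Ioo 0 (τ h), sector H ρ x₀ ∈ 𝓝 (γ h t) := fun t ht => by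
    have ht' := Ioo_subset_Icc_self ht
    have hx : HasDerivAt (fun s => (γ h s).1) (hamVF H (γ h t)).1 t := by
      have := (ContinuousLinearMap.fst ℝ ℝ ℝ).hasFDerivAt.comp_hasDerivAt t (hode t ht')
      exact this
    have hy : HasDerivAt (fun s => (γ h s).2) (hamVF H (γ h t)).2 t := by
      have := (ContinuousLinearMap.snd ℝ ℝ ℝ).hasFDerivAt.comp_hasDerivAt t (hode t ht')
      exact this
    have hlt : (γ h t).1 ^ 2 + (γ h t).2 ^ 2 < ρ ^ 2 := by
      refine lt_of_le_of_ne (hγball t ht') fun heq => ?_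
      have hmax : IsLocalMax (fun s => (γ h s).1 ^ 2 + (γ h s).2 ^ 2) t := by
        filter_upwards [Ioo_mem_nhds ht.1 ht.2] with s hs
        rw [heq]
        exact hγball s (Ioo_subset_Icc_self hs)
      have hzero := hmax.hasDerivAt_eq_zero ((hx.pow 2).add (hy.pow 2))
      refine htrans _ heq (abs_pos.2 (hγ0 t ht')) (by rwa [(hγmem t ht').2]) ?_
      simp only [hamVF] at hzero
      norm_num at hzero
      linarith
    have hnhds : {p ∈ euclBall ρ | H p ≠ 0} ∈ 𝓝 (γ h t) := by
      refine inter_mem ?_ ((hHan _ (hγball t ht')).continuousAt.eventually_ne (hγ0 t ht'))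
      exact mem_of_superset ((isOpen_lt (f := fun p : ℝ × ℝ => p.1 ^ 2 + p.2 ^ 2)
        (g := fun _ => ρ ^ 2) (by fun_prop) (by fun_prop)).mem_nhds hlt)
        fun p hp => (show p.1 ^ 2 + p.2 ^ 2 < ρ ^ 2 from hp).le
    rw [sector, connectedComponentIn_eq (hγmem t ht').1]
    exact connectedComponentIn_mem_nhds hnhds
  have hnear : ∀ W ∈ 𝓝ˢ {p ∈ sector H ρ x₀ | |H p| = h},
      ∃ ε > 0, ∀ p ∈ sector H ρ x₀, |(|H p|) - h| < ε → p ∈ W := fun W hW =>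
    exists_near_level_subset hh.1 (fun a ha => isCompact_sector_superlevel hx₀ hHcont ha)
      (hHcont.abs.mono fun p hp => (hsec p hp).1) hW
  have hmeas : ∀ᶠ a in 𝓝 h, ∀ b, MeasurableSet {p ∈ sector H ρ x₀ | a ≤ |H p| ∧ |H p| < b} := by
    filter_upwards [lt_mem_nhds hh.1] with a ha b
    have hb := (isCompact_sector_superlevel hx₀ hHcont (lt_max_of_lt_left (c := b) ha))
    convert (isCompact_sector_superlevel hx₀ hHcont ha).measurableSet.diff hb.measurableSet using 1
    ext p
    simp only [mem_ofPred_eq, Set.mem_sdiff, max_le_iff]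
    grind
  have hfin : volume (sector H ρ x₀) ≠ ⊤ :=
    measure_ne_top_of_subset (fun p hp => (hsec p hp).1) (isCompact_euclBall ρ).measure_ne_top
  refine hasDerivAt_volume_sublevel hτ.le hfin hmeas fun δ hδ => ?_
  refine exists_volume_levels_bounds (Ψ := Ψ) (F := fun q => (q.1, |H (Ψ q)| - h))
    (fun q => rfl) ?_ ?_ ?_ ?_ ?_ ?_ ?_ (hΨimg ▸ hnear) hδ
  · exact fun q hq => (hΨ' q hq).1 ▸ (hΨ q.1 hq.1).2.1.1
  · exact fun q hq => (hΨ' q hq).1 ▸ (hΨ q.1 hq.1).2.2.1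
  · exact fun q hq => (hΨ' q hq).1 ▸ (hΨ q.1 hq.1).2.1.2
  · exact fun q hq => (hΨ' q hq).1 ▸ (hΨ q.1 hq.1).2.2.2
  · intro q hq q' hq' heq
    rw [hΨγ q hq, hΨγ q' hq'] at heq
    exact Prod.ext (hinj hq.1 hq'.1 heq) (hq.2.trans hq'.2.symm)
  · intro q hq
    rw [hΨγ q hq]
    exact (hγmem q.1 hq.1).2
  · intro q hq
    rw [hΨγ q ⟨Ioo_subset_Icc_self hq.1, hq.2⟩]
    exact hint q.1 hq.1
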